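/- The renormalization of a renormalizable unimodal map is again a unimodal map of the same form and the same critical exponent: fix α > 1 and let f = φ ∘ q_t be a unimodal map with critical exponent α which is period-doubling renormalizable, with fixed point p ∈ (0,1), f(0) ≥ p and f(f(0)) ≥ -p. Then there exist a C² diffeomorphism ψ of [-1,1] onto itself with ψ(-1) = -1, ψ(1) = 1, ψ' > 0, and a peak-value ρ ∈ [0,1] such that (R f)(x) = -f(f(-p·x))/p equals (ψ ∘ q_ρ)(x) for all x ∈ [-1,1]; moreover the peak-value of the renormalization is ρ = (1 - f(f(0))/p)/2, so ρ = 0 when f(0) = p (lower boundary of the renormalization window) and ρ = 1 when f(f(0)) = -p (upper boundary of the renormalization window). -/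

import Mathlib

/-- The canonical folding map with critical exponent `α` and peak-value `t`:
`q_t(x) = -2t|x|^α + 2t - 1` (here `^` is the real power). -/
noncomputable def foldMap (α t x : ℝ) : ℝ := -2 * t * |x| ^ α + 2 * t - 1

/-- `IsDiffeo φ d1 d2` : `φ` is an orientation-preserving C² diffeomorphism of `[-1,1]`
onto itself fixing the endpoints, with first derivative `d1 > 0` and continuous second
derivative `d2`. -/
def IsDiffeo (φ d1 d2 : ℝ → ℝ) : Prop :=
  Set.BijOn φ (Set.Icc (-1 : ℝ) 1) (Set.Icc (-1 : ℝ) 1) ∧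
  φ (-1) = -1 ∧ φ 1 = 1 ∧
  (∀ x ∈ Set.Icc (-1 : ℝ) 1, HasDerivWithinAt φ (d1 x) (Set.Icc (-1 : ℝ) 1) x) ∧
  (∀ x ∈ Set.Icc (-1 : ℝ) 1, HasDerivWithinAt d1 (d2 x) (Set.Icc (-1 : ℝ) 1) x) ∧
  ContinuousOn d2 (Set.Icc (-1 : ℝ) 1) ∧
  (∀ x ∈ Set.Icc (-1 : ℝ) 1, 0 < d1 x)

open Set

/-- `IsC2On F F1 F2 S`: on `S` the function `F` has first derivative `F1` and continuous second
derivative `F2`. -/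
def IsC2On (F F1 F2 : ℝ → ℝ) (S : Set ℝ) : Prop :=
  (∀ x ∈ S, HasDerivWithinAt F (F1 x) S x) ∧ (∀ x ∈ S, HasDerivWithinAt F1 (F2 x) S x) ∧
    ContinuousOn F2 S

namespace IsC2On

variable {F F1 F2 G G1 G2 : ℝ → ℝ} {S T : Set ℝ}

theorem continuousOn (h : IsC2On F F1 F2 S) : ContinuousOn F S :=
  fun x hx => (h.1 x hx).continuousWithinAt

theorem continuousOn_deriv (h : IsC2On F F1 F2 S) : ContinuousOn F1 S :=
  fun x hx => (h.2.1 x hx).continuousWithinAt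

theorem comp (hG : IsC2On G G1 G2 T) (hF : IsC2On F F1 F2 S) (hm : MapsTo F S T) :
    IsC2On (fun x => G (F x)) (fun x => G1 (F x) * F1 x)
      (fun x => G2 (F x) * F1 x * F1 x + G1 (F x) * F2 x) S := by
  refine ⟨fun x hx => (hG.1 _ (hm hx)).comp x (hF.1 x hx) hm, fun x hx => ?_, ?_⟩
  · exact ((hG.2.1 _ (hm hx)).comp x (hF.1 x hx) hm).mul (hF.2.1 x hx)
  · have hG1 := hG.continuousOn_deriv.comp hF.continuousOn hm
    have hG2 := hG.2.2.comp hF.continuousOn hm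
    exact ((hG2.mul hF.continuousOn_deriv).mul hF.continuousOn_deriv).add (hG1.mul hF.2.2)

theorem affine (a b : ℝ) (S : Set ℝ) :
    IsC2On (fun x => a + b * x) (fun _ => b) (fun _ => 0) S := by
  refine ⟨fun x _ => ?_, fun x _ => hasDerivWithinAt_const x S b, continuousOn_const⟩
  simpa using (((hasDerivAt_id x).const_mul b).const_add a).hasDerivWithinAt

theorem strictMonoOn {a b : ℝ} (h : IsC2On F F1 F2 (Icc a b)) (hpos : ∀ x ∈ Icc a b, 0 < F1 x) :
    StrictMonoOn F (Icc a b) :=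
  strictMonoOn_of_hasDerivWithinAt_pos (convex_Icc a b) h.continuousOn
    (fun x hx => (h.1 x (interior_subset hx)).mono interior_subset)
    (fun x hx => hpos x (interior_subset hx))

theorem isDiffeo (h : IsC2On F F1 F2 (Icc (-1) 1)) (hpos : ∀ x ∈ Icc (-1 : ℝ) 1, 0 < F1 x)
    (hl : F (-1) = -1) (hr : F 1 = 1) : IsDiffeo F F1 F2 := by
  have hmono := h.strictMonoOn hpos
  have hl' : (-1 : ℝ) ∈ Icc (-1 : ℝ) 1 := by simp
  have hr' : (1 : ℝ) ∈ Icc (-1 : ℝ) 1 := by simp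
  refine ⟨⟨fun x hx => ⟨?_, ?_⟩, hmono.injOn, ?_⟩, hl, hr, h.1, h.2.1, h.2.2, hpos⟩
  · exact hl ▸ hmono.monotoneOn hl' hx hx.1
  · exact hr ▸ hmono.monotoneOn hx hr' hx.2
  · have := intermediate_value_Icc (by norm_num : (-1 : ℝ) ≤ 1) h.continuousOn
    rwa [hl, hr] at this

end IsC2On

theorem IsDiffeo.isC2On {φ d1 d2 : ℝ → ℝ} (h : IsDiffeo φ d1 d2) :
    IsC2On φ d1 d2 (Icc (-1) 1) :=
  ⟨h.2.2.2.1, h.2.2.2.2.1, h.2.2.2.2.2.1⟩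

theorem HasDerivWithinAt.ite_Icc {a b c : ℝ} (hab : a ≤ b) (hbc : b ≤ c) {F F1 G G1 : ℝ → ℝ}
    (hF : ∀ x ∈ Icc a b, HasDerivWithinAt F (F1 x) (Icc a b) x)
    (hG : ∀ x ∈ Icc b c, HasDerivWithinAt G (G1 x) (Icc b c) x)
    (h0 : F b = G b) (h1 : F1 b = G1 b) {x : ℝ} (hx : x ∈ Icc a c) :
    HasDerivWithinAt (fun y => if y ≤ b then F y else G y) (if x ≤ b then F1 x else G1 x)
      (Icc a c) x := by
  have hFl : EqOn (fun y => if y ≤ b then F y else G y) F (Icc a b) := fun y hy => if_pos hy.2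
  have hGr : EqOn (fun y => if y ≤ b then F y else G y) G (Icc b c) := fun y hy => by
    rcases hy.1.eq_or_lt with rfl | h
    · simpa using h0
    · exact if_neg h.not_ge
  rw [← Icc_union_Icc_eq_Icc hab hbc]
  refine HasDerivWithinAt.union ?_ ?_
  · by_cases hxb : x ≤ b
    · rw [if_pos hxb]
      exact (hF x ⟨hx.1, hxb⟩).congr hFl (hFl ⟨hx.1, hxb⟩)
    · refine HasFDerivWithinAt.of_notMem_closure ?_
      rw [isClosed_Icc.closure_eq]
      exact fun h => hxb h.2
  · by_cases hbx : b ≤ x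
    · have : (if x ≤ b then F1 x else G1 x) = G1 x := by
        rcases hbx.eq_or_lt with rfl | h
        · simpa using h1
        · exact if_neg h.not_ge
      rw [this]
      exact (hG x ⟨hbx, hx.2⟩).congr hGr (hGr ⟨hbx, hx.2⟩)
    · refine HasFDerivWithinAt.of_notMem_closure ?_
      rw [isClosed_Icc.closure_eq]
      exact fun h => hbx h.1

theorem IsC2On.ite_Icc {a b c : ℝ} (hab : a ≤ b) (hbc : b ≤ c) {F F1 F2 G G1 G2 : ℝ → ℝ}
    (hF : IsC2On F F1 F2 (Icc a b)) (hG : IsC2On G G1 G2 (Icc b c))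
    (h0 : F b = G b) (h1 : F1 b = G1 b) (h2 : F2 b = G2 b) :
    IsC2On (fun y => if y ≤ b then F y else G y) (fun y => if y ≤ b then F1 y else G1 y)
      (fun y => if y ≤ b then F2 y else G2 y) (Icc a c) := by
  refine ⟨fun x hx => .ite_Icc hab hbc hF.1 hG.1 h0 h1 hx,
    fun x hx => .ite_Icc hab hbc hF.2.1 hG.2.1 h1 h2 hx, ?_⟩
  rw [← Icc_union_Icc_eq_Icc hab hbc]
  refine ContinuousOn.union_of_isClosed ?_ ?_ isClosed_Icc isClosed_Icc
  · exact hF.2.2.congr fun y hy => if_pos hy.2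
  · refine hG.2.2.congr fun y hy => ?_
    rcases hy.1.eq_or_lt with rfl | h
    · simpa using h2
    · exact if_neg h.not_ge

/-- A polynomial increasing diffeomorphism of `[0,1]` with prescribed derivatives `m > 0` and `k`
at `1`. -/
theorem exists_unitInterval_diffeo_with_jet {m : ℝ} (hm : 0 < m) (k : ℝ) :
    ∃ P P1 P2 : ℝ → ℝ, (∀ x, HasDerivAt P (P1 x) x) ∧ (∀ x, HasDerivAt P1 (P2 x) x) ∧
      Continuous P2 ∧ (∀ x ∈ Icc (0 : ℝ) 1, 0 < P1 x) ∧ P 0 = 0 ∧ P 1 = 1 ∧ P1 1 = m ∧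
      P2 1 = k := by
  obtain ⟨n, hn⟩ := exists_nat_gt (max (|k| / m) (2 * m + |k|))
  have hn1 : |k| < n * m := (div_lt_iff₀ hm).1 ((le_max_left _ _).trans_lt hn)
  have hn2 : 2 * m + |k| < n := (le_max_right _ _).trans_lt hn
  obtain ⟨B, hB⟩ : ∃ B, B = (n + 1) * m - k := ⟨_, rfl⟩
  have hB0 : 0 < B := by have := le_abs_self k; linarith
  have hn0 : (0 : ℝ) ≤ n := n.cast_nonneg
  obtain ⟨C, hC⟩ : ∃ C, C = 3 * (1 - ((m + B) / (n + 2) - B / (n + 3))) := ⟨_, rfl⟩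
  have hC0 : 0 < C := by
    have key : (m + B) / (n + 2) - B / (n + 3) < 1 := by
      have : (m + B) / (n + 2) - B / (n + 3) = (m * (n + 3) + B) / ((n + 2) * (n + 3)) := by
        field_simp
        ring
      rw [this, div_lt_one (by positivity)]
      have := neg_abs_le k
      have := abs_nonneg k
      nlinarith
    rw [hC]
    linarith
  refine ⟨fun x => (m + B) / (n + 2) * x ^ (n + 2) - B / (n + 3) * x ^ (n + 3) +
      C / 3 * (1 - (1 - x) ^ 3),
    fun x => (m + B) * x ^ (n + 1) - B * x ^ (n + 2) + C * (1 - x) ^ 2,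
    fun x => (m + B) * (n + 1) * x ^ n - B * (n + 2) * x ^ (n + 1) - 2 * C * (1 - x),
    fun x => ?_, fun x => ?_, by fun_prop, fun x hx => ?_, ?_, ?_, ?_, ?_⟩
  · have h := (((hasDerivAt_pow (n + 2) x).const_mul ((m + B) / (n + 2))).sub
      ((hasDerivAt_pow (n + 3) x).const_mul (B / (n + 3)))).add
      (((((hasDerivAt_id x).const_sub 1).pow 3).const_sub 1).const_mul (C / 3))
    refine h.congr_deriv ?_
    simp
    field_simp
  · have h := (((hasDerivAt_pow (n + 1) x).const_mul (m + B)).sub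
      ((hasDerivAt_pow (n + 2) x).const_mul B)).add
      ((((hasDerivAt_id x).const_sub 1).pow 2).const_mul C)
    refine h.congr_deriv ?_
    simp
    ring
  · dsimp only
    have e : (m + B) * x ^ (n + 1) - B * x ^ (n + 2) + C * (1 - x) ^ 2 =
        (m + B * (1 - x)) * x ^ (n + 1) + C * (1 - x) ^ 2 := by ring
    rw [e]
    have hx1 : 0 ≤ 1 - x := by linarith [hx.2]
    rcases hx.1.eq_or_lt with rfl | h
    · simpa using hC0
    · positivity
  · simp
  · simp [hC]
  · simp
  · simp [hB]
    ring

/-- An increasing C² map of `[-1,b]` onto itself extends to a C² diffeomorphism of `[-1,1]`. -/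
theorem IsC2On.exists_isDiffeo_eqOn {b : ℝ} (hb : -1 ≤ b) (hb1 : b ≤ 1) {F F1 F2 : ℝ → ℝ}
    (hF : IsC2On F F1 F2 (Icc (-1) b)) (hpos : ∀ x ∈ Icc (-1) b, 0 < F1 x)
    (hl : F (-1) = -1) (hr : F b = b) :
    ∃ ψ e1 e2 : ℝ → ℝ, IsDiffeo ψ e1 e2 ∧ EqOn ψ F (Icc (-1) b) := by
  rcases hb1.eq_or_lt with rfl | hb1
  · exact ⟨F, F1, F2, hF.isDiffeo hpos hl hr, fun _ _ => rfl⟩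
  have hL : 0 < 1 - b := sub_pos.2 hb1
  obtain ⟨P, P1, P2, hP1, hP2, hPc, hPpos, hP0, hPr, hm, hk⟩ :=
    exists_unitInterval_diffeo_with_jet (hpos b ⟨hb, le_rfl⟩) (-(1 - b) * F2 b)
  have hP : IsC2On P P1 P2 univ :=
    ⟨fun x _ => (hP1 x).hasDerivWithinAt, fun x _ => (hP2 x).hasDerivWithinAt, hPc.continuousOn⟩
  have hG := (IsC2On.affine 1 (-(1 - b)) univ).comp
    (hP.comp (IsC2On.affine (1 / (1 - b)) (-1 / (1 - b)) (Icc b 1)) (mapsTo_univ _ _))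
    (mapsTo_univ _ _)
  have hv : ∀ x, 1 / (1 - b) + -1 / (1 - b) * x = (1 - x) / (1 - b) := fun x => by ring
  have hvb : (1 - b) / (1 - b) = 1 := div_self hL.ne'
  have hH := hF.ite_Icc hb hb1.le hG (by simp only [hv, hvb, hPr, hr]; ring)
    (by simp only [hv, hvb, hm]; field_simp)
    (by simp only [hv, hvb, hk]; field_simp; ring)
  refine ⟨_, _, _, hH.isDiffeo (fun x hx => ?_) ?_ ?_, fun x hx => if_pos hx.2⟩
  · split_ifs with h
    · exact hpos x ⟨hx.1, h⟩
    · have := hPpos ((1 - x) / (1 - b)) ⟨div_nonneg (by linarith [hx.2]) hL.le,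
        (div_le_one hL).2 (by linarith)⟩
      rw [hv]
      field_simp
      linarith
  · simp only [if_pos hb, hl]
  · simp only [if_neg hb1.not_ge, hv]
    simp [hP0]

theorem foldMap_mem_Icc {α t x : ℝ} (hα : 0 ≤ α) (ht : 0 ≤ t) (hx : x ∈ Icc (-1 : ℝ) 1) :
    foldMap α t x ∈ Icc (-1) (2 * t - 1) := by
  have h0 : 0 ≤ |x| ^ α := by positivity
  have h1 : |x| ^ α ≤ 1 := Real.rpow_le_one (abs_nonneg x) (abs_le.2 hx) hα
  unfold foldMap
  constructor <;> nlinarith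

theorem foldMap_strictAntiOn {α t : ℝ} (hα : 0 < α) (ht : 0 < t) :
    StrictAntiOn (foldMap α t) (Ici 0) := by
  intro x hx y hy hxy
  have := Real.rpow_lt_rpow hx hxy hα
  simp only [foldMap, abs_of_nonneg (mem_Ici.1 hx), abs_of_nonneg (mem_Ici.1 hy)]
  nlinarith

theorem foldMap_isC2On (α t : ℝ) {S : Set ℝ} (hS : S ⊆ Ioi 0) :
    IsC2On (foldMap α t) (fun x => -2 * t * (α * x ^ (α - 1)))
      (fun x => -2 * t * (α * ((α - 1) * x ^ (α - 1 - 1)))) S := by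
  refine ⟨fun x hx => ?_, fun x hx => ?_, fun x hx => ?_⟩
  · have h := (((Real.hasDerivAt_rpow_const (p := α) (Or.inl (hS hx).ne')).const_mul
      (-2 * t)).add_const (2 * t)).sub_const 1
    exact h.hasDerivWithinAt.congr (fun y hy => by simp [foldMap, abs_of_pos (mem_Ioi.1 (hS hy))])
      (by simp [foldMap, abs_of_pos (mem_Ioi.1 (hS hx))])
  · exact (((Real.hasDerivAt_rpow_const (Or.inl (hS hx).ne')).const_mul α).const_mul
      (-2 * t)).hasDerivWithinAt
  · exact ((((Real.continuousAt_rpow_const x _ (Or.inl (hS hx).ne')).const_mul (α - 1)).const_mul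
      α).const_mul (-2 * t)).continuousWithinAt

/-- The renormalization of a period-doubling renormalizable unimodal map `f = φ ∘ q_t` with
critical exponent `α` is again a unimodal map with critical exponent `α`:
`(R f)(x) = -f(f(-p·x))/p = ψ (q_ρ x)` for some orientation-preserving C² diffeomorphism
`ψ` of `[-1,1]` fixing the endpoints, with peak-value `ρ = (1 - f(f(0))/p)/2 ∈ [0,1]`; in
particular `ρ = 0` when `f 0 = p` and `ρ = 1` when `f (f 0) = -p`. -/
theorem renormalization_is_unimodal (α : ℝ) (hα : 1 < α)
    (φ d1 d2 : ℝ → ℝ) (hφ : IsDiffeo φ d1 d2)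
    (t : ℝ) (ht : t ∈ Set.Icc (0 : ℝ) 1)
    (f : ℝ → ℝ) (hf : ∀ x, f x = φ (foldMap α t x))
    (p : ℝ) (hp : p ∈ Set.Ioo (0 : ℝ) 1) (hfix : f p = p)
    (h1 : p ≤ f 0) (h2 : -p ≤ f (f 0)) :
    ∃ ψ e1 e2 : ℝ → ℝ, ∃ ρ : ℝ, IsDiffeo ψ e1 e2 ∧ ρ ∈ Set.Icc (0 : ℝ) 1 ∧
      (∀ x ∈ Set.Icc (-1 : ℝ) 1, -f (f (-p * x)) / p = ψ (foldMap α ρ x)) ∧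
      ρ = (1 - f (f 0) / p) / 2 ∧
      (f 0 = p → ρ = 0) ∧
      (f (f 0) = -p → ρ = 1) := by
  have hα0 : 0 < α := one_pos.trans hα
  obtain ⟨hp0, hp1⟩ := hp
  have hC := hφ.isC2On
  have hd1 := hφ.2.2.2.2.2.2
  have hmono := hC.strictMonoOn hd1
  have hq : ∀ {x}, x ∈ Icc (-1 : ℝ) 1 → foldMap α t x ∈ Icc (-1 : ℝ) 1 := fun hx =>
    Icc_subset_Icc le_rfl (by linarith [ht.2]) (foldMap_mem_Icc hα0.le ht.1 hx)
  have hpI : p ∈ Icc (-1 : ℝ) 1 := ⟨by linarith, hp1.le⟩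
  have h0I : (0 : ℝ) ∈ Icc (-1 : ℝ) 1 := by simp
  have ht0 : 0 < t := by
    refine ht.1.lt_of_ne fun h => ?_
    have : f p = -1 := by simp [hf, foldMap, ← h, hφ.2.1]
    linarith
  have hanti := foldMap_strictAntiOn hα0 ht0
  have hfI : f 0 ∈ Icc (-1 : ℝ) 1 := by
    rw [hf]
    exact hφ.1.mapsTo (hq h0I)
  have hpf : p < f 0 := by
    rw [← hfix, hf, hf 0]
    exact hmono (hq hpI) (hq h0I) (hanti (by simp) hp0.le hp0)
  have hff : f (f 0) < p := by
    refine lt_of_lt_of_eq ?_ hfix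
    rw [hf (f 0), hf p]
    exact hmono (hq hfI) (hq hpI) (hanti hp0.le (hp0.trans hpf).le hpf)
  obtain ⟨ρ, hρ⟩ : ∃ ρ, ρ = (1 - f (f 0) / p) / 2 := ⟨_, rfl⟩
  have hρ0 : 0 < ρ := by
    have := (div_lt_one hp0).2 hff
    linarith
  have hρ1 : ρ ≤ 1 := by
    have : -1 ≤ f (f 0) / p := by rw [le_div_iff₀ hp0]; linarith
    linarith
  have hpα : 0 < p ^ α := Real.rpow_pos_of_pos hp0 α
  have hκ : 0 < t * p ^ α / ρ := by positivity
  have hA0 : ∀ x, foldMap α t p + t * p ^ α / ρ + t * p ^ α / ρ * foldMap α ρ x =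
      foldMap α t (-p * x) := fun x => by
    simp only [foldMap, abs_mul, abs_neg, abs_of_pos hp0,
      Real.mul_rpow hp0.le (abs_nonneg x)]
    field_simp
    ring
  have hA : MapsTo (fun u => foldMap α t p + t * p ^ α / ρ + t * p ^ α / ρ * u)
      (Icc (-1) (2 * ρ - 1)) (Icc (foldMap α t p) (foldMap α t 0)) := by
    intro u hu
    have e0 := hA0 0
    have e1 : foldMap α ρ 0 = 2 * ρ - 1 := by simp [foldMap, hα0.ne']
    rw [e1, mul_zero] at e0
    refine ⟨?_, ?_⟩
    · nlinarith [hu.1]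
    · rw [← e0]
      nlinarith [hu.2]
  have hsub : Icc (foldMap α t p) (foldMap α t 0) ⊆ Icc (-1) 1 :=
    Icc_subset_Icc (hq hpI).1 (hq h0I).2
  have hφm : MapsTo φ (Icc (foldMap α t p) (foldMap α t 0)) (Icc p 1) := fun y hy =>
    ⟨by rw [← hfix, hf]; exact hmono.monotoneOn (hq hpI) (hsub hy) hy.1,
      (hφ.1.mapsTo (hsub hy)).2⟩
  have hp1I : Icc p 1 ⊆ Icc (-1) 1 := Icc_subset_Icc hpI.1 le_rfl
  have hF1 := hC.comp (IsC2On.affine (foldMap α t p + t * p ^ α / ρ) (t * p ^ α / ρ) _)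
    (hA.mono_right hsub)
  have hF2 := (foldMap_isC2On α t (S := Icc p 1) fun x hx => hp0.trans_le hx.1).comp hF1
    (hφm.comp hA)
  have hF3 := (IsC2On.affine 0 (-1 / p) univ).comp
    (hC.comp hF2 fun u hu => hq (hp1I (hφm (hA hu)))) (mapsTo_univ _ _)
  obtain ⟨ψ, e1, e2, hψ, hψF⟩ := hF3.exists_isDiffeo_eqOn (by linarith) (by linarith)
    (fun u hu => by
      have hy := hφm (hA hu)
      have hpow := Real.rpow_pos_of_pos (hp0.trans_le hy.1) (α - 1)
      have g1 := hd1 _ (hsub (hA hu))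
      have g2 := hd1 _ (hq (hp1I hy))
      dsimp only at hpow g1 g2 ⊢
      have hp' : 0 < 1 / p := by positivity
      have := mul_pos hp' (mul_pos g2 (mul_pos (mul_pos (mul_pos two_pos ht0)
        (mul_pos hα0 hpow)) (mul_pos g1 hκ)))
      refine this.trans_eq ?_
      ring)
    (by
      have := hA0 1
      rw [show foldMap α ρ 1 = -1 by simp [foldMap]] at this
      have e : foldMap α t (-p * 1) = foldMap α t p := by simp [foldMap]
      rw [this, e, ← hf p, hfix, ← hf p, hfix]
      field_simp
      ring)
    (by
      have := hA0 0
      rw [show foldMap α ρ 0 = 2 * ρ - 1 by simp [foldMap, hα0.ne'], mul_zero] at this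
      rw [this, ← hf, ← hf, hρ]
      ring)
  refine ⟨ψ, e1, e2, ρ, hψ, ⟨hρ0.le, hρ1⟩, fun x hx => ?_, hρ, fun h => absurd h hpf.ne',
    fun h => ?_⟩
  · rw [hψF (foldMap_mem_Icc hα0.le hρ0.le hx)]
    dsimp only
    rw [hA0, ← hf, ← hf]
    ring
  · rw [hρ, h]
    field_simp
    norm_num
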